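/- Let N ≥ 2, let a be an N×N complex matrix, b and c be N×N complex matrices, set A = (0, a; a*, 0) and B = diag(b, c) as 2N×2N block matrices, and let U range over the matrices diag(V, V̄) with V drawn from the normalized Haar measure on U(N). Then ⟨Tr(U*AUBU*AUB)⟩ = (2·Tr(a*a)·(N·Tr(b)·Tr(c) − Tr(b·cᵗ)) + 2·Tr(ā·a)·(N·Tr(b·cᵗ) − Tr(b)·Tr(c))) / (N(N²−1)). -/

import Mathlib

open MeasureTheory Matrix

noncomputable instance (m n α : Type*) [MeasurableSpace α] : MeasurableSpace (Matrix m n α) :=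
  (inferInstance : MeasurableSpace (m → n → α))

/-- The `2N×2N` block-diagonal matrix `diag(V, V̄)` built from an `N×N` matrix `V`. -/
def Ublk {N : ℕ} (V : Matrix (Fin N) (Fin N) ℂ) :
    Matrix (Fin N ⊕ Fin N) (Fin N ⊕ Fin N) ℂ :=
  Matrix.fromBlocks V 0 0 Vᴴᵀ

theorem eq_zero_of_eq_mul_self {c z : ℂ} (hc : c ≠ 1) (h : z = c * z) : z = 0 := by
  by_contra hz
  exact hc (mul_right_cancel₀ hz (by rw [← h, one_mul]))

/-- The coordinate form of invariance of a tensor under simultaneous unitary conjugation of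
both pairs of indices. -/
def ConjInvariant {n : Type*} [Fintype n] [DecidableEq n] (f : n → n → n → n → ℂ) : Prop :=
  ∀ S ∈ Matrix.unitaryGroup n ℂ, ∀ q k p l, f q k p l =
    ∑ q', ∑ k', ∑ p', ∑ l',
      S q q' * star (S k k') * (S p p' * star (S l l')) * f q' k' p' l'

namespace ConjInvariant

variable {n : Type*} [Fintype n] [DecidableEq n] {f : n → n → n → n → ℂ}

theorem eq_diagonal_mul (hf : ConjInvariant f) (d : n → ℂ) (hd : ∀ i, d i * star (d i) = 1)
    (q k p l : n) :
    f q k p l = d q * star (d k) * (d p * star (d l)) * f q k p l := by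
  have hS : Matrix.diagonal d ∈ Matrix.unitaryGroup n ℂ := by
    rw [Matrix.mem_unitaryGroup_iff, Matrix.star_eq_conjTranspose, Matrix.diagonal_conjTranspose,
      Matrix.diagonal_mul_diagonal]
    simp only [Pi.star_apply, hd, Matrix.diagonal_one]
  have h := hf _ hS q k p l
  simpa [Matrix.diagonal_apply, apply_ite, ite_mul, mul_ite] using h

theorem eq_perm (hf : ConjInvariant f) (σ : Equiv.Perm n) (q k p l : n) :
    f q k p l = f (σ q) (σ k) (σ p) (σ l) := by
  have hS : (Matrix.of fun i j => if σ i = j then (1 : ℂ) else 0) ∈ Matrix.unitaryGroup n ℂ := by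
    rw [Matrix.mem_unitaryGroup_iff]
    ext i j
    simp [Matrix.mul_apply, Matrix.one_apply, Matrix.star_apply, apply_ite, eq_comm]
  have h := hf _ hS q k p l
  simpa [apply_ite, ite_mul, mul_ite] using h

theorem eq_zero (hf : ConjInvariant f) {q k p l : n}
    (h₁ : ¬ (q = k ∧ p = l)) (h₂ : ¬ (q = l ∧ p = k)) : f q k p l = 0 := by
  have h (x : n) := hf.eq_diagonal_mul (fun i => if i = x then Complex.I else 1)
    (fun i => by split_ifs <;> simp) q k p l
  have hq := h q
  have hp := h p
  clear h
  by_cases hqp : q = p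
  · subst hqp
    refine eq_zero_of_eq_mul_self ?_ hq
    clear hq hp
    by_cases hk : k = q <;> by_cases hl : l = q
    · exact absurd ⟨hk.symm, hl.symm⟩ h₁
    all_goals simp [hk, hl, Complex.ext_iff] <;> norm_num
  · have hpq : p ≠ q := fun h => hqp h.symm
    by_cases hk : k = q
    · refine eq_zero_of_eq_mul_self ?_ hp
      have hl : l ≠ p := fun h => h₁ ⟨hk.symm, h.symm⟩
      simp [hk, hl, hqp, Complex.ext_iff]
    · by_cases hl : l = q
      · refine eq_zero_of_eq_mul_self ?_ hp
        have hk' : k ≠ p := fun h => h₂ ⟨hl.symm, h.symm⟩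
        simp [hk', hl, hqp, Complex.ext_iff]
      · refine eq_zero_of_eq_mul_self ?_ hq
        simp [hk, hl, hpq, Complex.ext_iff]

theorem exists_unitary_row {x y : n} (hxy : x ≠ y) :
    ∃ S ∈ Matrix.unitaryGroup n ℂ,
      ∀ j, S x j = (if x = j then 3 / 5 else 0) + (if y = j then -(4 / 5) else 0) := by
  set w : n → ℂ := Pi.single x 1 + Pi.single y 2 with hw
  have hww : w ⬝ᵥ w = 5 := by
    simp [hw, hxy, hxy.symm]
    norm_num
  have hws : star w = w := by
    ext j
    simp only [hw, Pi.star_apply, Pi.add_apply, Pi.single_apply]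
    split_ifs <;> simp
  refine ⟨1 - (2 / 5 : ℂ) • Matrix.vecMulVec w w, ?_, fun j => ?_⟩
  · rw [Matrix.mem_unitaryGroup_iff, Matrix.star_eq_conjTranspose, Matrix.conjTranspose_sub,
      Matrix.conjTranspose_smul, Matrix.conjTranspose_vecMulVec, hws, Matrix.conjTranspose_one]
    simp only [sub_mul, mul_sub, one_mul, mul_one, Matrix.smul_mul, Matrix.mul_smul,
      Matrix.vecMulVec_mul_vecMulVec, hww, star_div₀, star_ofNat]
    ext i j
    simp [Matrix.vecMulVec_apply]
    ring
  · simp [Matrix.vecMulVec_apply, hw, Matrix.one_apply, Pi.single_apply, hxy, eq_comm]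
    split_ifs <;> norm_num

theorem diag_eq_add (hf : ConjInvariant f) {x y : n} (hxy : x ≠ y) :
    f x x x x = f x x y y + f x y y x := by
  obtain ⟨S, hS, hrow⟩ := exists_unitary_row hxy
  have h := hf S hS x x x x
  simp only [hrow, star_add, apply_ite star, star_zero, star_neg, star_div₀, star_ofNat, add_mul,
    mul_add, Finset.sum_add_distrib, ite_mul, mul_ite, zero_mul, mul_zero, Finset.sum_ite_eq,
    Finset.mem_univ, if_true] at h
  have e₁ := hf.eq_perm (Equiv.swap x y) x x x x
  have e₂ := hf.eq_perm (Equiv.swap x y) x x y y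
  have e₃ := hf.eq_perm (Equiv.swap x y) x y y x
  simp only [Equiv.swap_apply_left, Equiv.swap_apply_right] at e₁ e₂ e₃
  have z (q k p l : n) (h₁ : ¬ (q = k ∧ p = l)) (h₂ : ¬ (q = l ∧ p = k)) := hf.eq_zero h₁ h₂
  have hyx := hxy.symm
  rw [z x x x y, z x x y x, z x y x x, z y x x x, z y y y x, z y y x y, z y x y y, z x y y y,
    z x y x y, z y x y x] at h <;> try simp [hxy, hyx]
  linear_combination (625 / 288 : ℂ) * h - (256 / 288 : ℂ) * e₁ - (1 / 2 : ℂ) * e₂ -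
    (1 / 2 : ℂ) * e₃

theorem exists_coeff [Nontrivial n] (hf : ConjInvariant f) :
    ∃ α β : ℂ, ∀ q k p l, f q k p l =
      α * ((1 : Matrix n n ℂ) q k * (1 : Matrix n n ℂ) p l) +
      β * ((1 : Matrix n n ℂ) q l * (1 : Matrix n n ℂ) p k) := by
  obtain ⟨x, y, hxy⟩ := exists_pair_ne n
  have key (u v : n) (huv : u ≠ v) : ∃ σ : Equiv.Perm n, σ u = x ∧ σ v = y := by
    refine ⟨Equiv.swap (Equiv.swap u x v) y * Equiv.swap u x, ?_, ?_⟩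
    · have : x ≠ Equiv.swap u x v := by
        rw [ne_eq, eq_comm, Equiv.swap_apply_eq_iff, Equiv.swap_apply_right]
        exact huv.symm
      simp [Equiv.swap_apply_of_ne_of_ne this hxy]
    · simp
  refine ⟨f x x y y, f x y y x, fun q k p l => ?_⟩
  by_cases hqp : q = p
  · subst hqp
    by_cases hk : q = k
    · subst hk
      by_cases hl : q = l
      · subst hl
        rw [hf.eq_perm (Equiv.swap q x)]
        simp [hf.diag_eq_add hxy]
      · rw [hf.eq_zero] <;> simp [hl]
    · rw [hf.eq_zero] <;> simp [Matrix.one_apply, hk]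
  · obtain ⟨σ, hσq, hσp⟩ := key q p hqp
    have hpq : p ≠ q := fun h => hqp h.symm
    by_cases h₁ : q = k ∧ p = l
    · obtain ⟨rfl, rfl⟩ := h₁
      rw [hf.eq_perm σ, hσq, hσp]
      simp [Matrix.one_apply, hqp]
    · by_cases h₂ : q = l ∧ p = k
      · obtain ⟨rfl, rfl⟩ := h₂
        rw [hf.eq_perm σ, hσq, hσp]
        simp [Matrix.one_apply, hqp]
      · rw [hf.eq_zero h₁ h₂]
        simp only [Matrix.one_apply]
        split_ifs <;> simp_all

end ConjInvariant

section Moments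

variable {N : ℕ} {μ : Measure (Matrix (Fin N) (Fin N) ℂ)}

theorem measurable_matrix_entry (i j : Fin N) :
    Measurable fun V : Matrix (Fin N) (Fin N) ℂ => V i j :=
  (measurable_pi_apply j).comp (measurable_pi_apply (X := fun _ : Fin N => Fin N → ℂ) i)

theorem measurable_matrix_mul_left (S : Matrix (Fin N) (Fin N) ℂ) :
    Measurable fun V : Matrix (Fin N) (Fin N) ℂ => S * V := by
  refine measurable_pi_iff.2 fun i => measurable_pi_iff.2 fun j => ?_
  simp only [Matrix.mul_apply]
  exact Finset.measurable_sum _ fun k _ => (measurable_matrix_entry k j).const_mul _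

theorem measurable_conj_entry (b : Matrix (Fin N) (Fin N) ℂ) (i j : Fin N) :
    Measurable fun V : Matrix (Fin N) (Fin N) ℂ => (V * b * Vᴴ) i j := by
  simp only [Matrix.mul_apply, Matrix.conjTranspose_apply]
  refine Finset.measurable_sum _ fun k _ => Measurable.mul ?_ ?_
  · exact Finset.measurable_sum _ fun l _ => (measurable_matrix_entry i l).mul_const _
  · exact Complex.continuous_conj.measurable.comp (measurable_matrix_entry j k)

theorem norm_conj_entry_le (b V : Matrix (Fin N) (Fin N) ℂ)
    (hV : V ∈ Matrix.unitaryGroup (Fin N) ℂ) (i j : Fin N) :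
    ‖(V * b * Vᴴ) i j‖ ≤ ∑ k, ∑ l, ‖b l k‖ := by
  simp only [Matrix.mul_apply, Matrix.conjTranspose_apply]
  refine (norm_sum_le _ _).trans (Finset.sum_le_sum fun k _ => ?_)
  rw [norm_mul, norm_star]
  refine (mul_le_of_le_one_right (norm_nonneg _) (entry_norm_bound_of_unitary hV j k)).trans ?_
  refine (norm_sum_le _ _).trans (Finset.sum_le_sum fun l _ => ?_)
  rw [norm_mul]
  exact mul_le_of_le_one_left (norm_nonneg _) (entry_norm_bound_of_unitary hV i l)

theorem integrable_conj_entry_mul [IsProbabilityMeasure μ]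
    (hmem : ∀ᵐ V ∂μ, V ∈ Matrix.unitaryGroup (Fin N) ℂ) (b c : Matrix (Fin N) (Fin N) ℂ)
    (q k p l : Fin N) :
    Integrable (fun V => (V * b * Vᴴ) q k * (V * c * Vᴴ) p l) μ := by
  refine Integrable.of_bound
    ((measurable_conj_entry b q k).mul (measurable_conj_entry c p l)).aestronglyMeasurable
    ((∑ k, ∑ l, ‖b l k‖) * ∑ k, ∑ l, ‖c l k‖) ?_
  filter_upwards [hmem] with V hV
  rw [norm_mul]
  exact mul_le_mul (norm_conj_entry_le b V hV q k) (norm_conj_entry_le c V hV p l)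
    (norm_nonneg _) (by positivity)

theorem integral_sum_conj_entry_mul [IsProbabilityMeasure μ]
    (hmem : ∀ᵐ V ∂μ, V ∈ Matrix.unitaryGroup (Fin N) ℂ) (b c : Matrix (Fin N) (Fin N) ℂ)
    (g : Fin N → Fin N → Fin N → Fin N → ℂ) :
    ∫ V, ∑ q, ∑ k, ∑ p, ∑ l, g q k p l * ((V * b * Vᴴ) q k * (V * c * Vᴴ) p l) ∂μ =
      ∑ q, ∑ k, ∑ p, ∑ l, g q k p l * ∫ V, (V * b * Vᴴ) q k * (V * c * Vᴴ) p l ∂μ := by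
  have h (q k p l : Fin N) :
      Integrable (fun V => g q k p l * ((V * b * Vᴴ) q k * (V * c * Vᴴ) p l)) μ :=
    (integrable_conj_entry_mul hmem b c q k p l).const_mul _
  rw [integral_finsetSum _ fun q _ => integrable_finsetSum _ fun k _ =>
    integrable_finsetSum _ fun p _ => integrable_finsetSum _ fun l _ => h q k p l]
  refine Finset.sum_congr rfl fun q _ => ?_
  rw [integral_finsetSum _ fun k _ => integrable_finsetSum _ fun p _ =>
    integrable_finsetSum _ fun l _ => h q k p l]
  refine Finset.sum_congr rfl fun k _ => ?_
  rw [integral_finsetSum _ fun p _ => integrable_finsetSum _ fun l _ => h q k p l]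
  refine Finset.sum_congr rfl fun p _ => ?_
  rw [integral_finsetSum _ fun l _ => h q k p l]
  exact Finset.sum_congr rfl fun l _ => integral_const_mul _ _

theorem mul_mul_conjTranspose_apply (S Y : Matrix (Fin N) (Fin N) ℂ) (q k : Fin N) :
    (S * Y * Sᴴ) q k = ∑ q', ∑ k', S q q' * star (S k k') * Y q' k' := by
  simp only [Matrix.mul_apply, Matrix.conjTranspose_apply, Finset.sum_mul]
  rw [Finset.sum_comm]
  exact Finset.sum_congr rfl fun _ _ => Finset.sum_congr rfl fun _ _ => by ring

theorem conjInvariant_moment [IsProbabilityMeasure μ]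
    (hmem : ∀ᵐ V ∂μ, V ∈ Matrix.unitaryGroup (Fin N) ℂ)
    (hinv : ∀ S ∈ Matrix.unitaryGroup (Fin N) ℂ, μ.map (fun V => S * V) = μ)
    (b c : Matrix (Fin N) (Fin N) ℂ) :
    ConjInvariant fun q k p l => ∫ V, (V * b * Vᴴ) q k * (V * c * Vᴴ) p l ∂μ := by
  intro S hS q k p l
  dsimp only
  rw [← integral_sum_conj_entry_mul hmem b c
    fun q' k' p' l' => S q q' * star (S k k') * (S p p' * star (S l l'))]
  conv_lhs => rw [← hinv S hS]
  have hm : Measurable fun V : Matrix (Fin N) (Fin N) ℂ => (V * b * Vᴴ) q k * (V * c * Vᴴ) p l :=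
    (measurable_conj_entry b q k).mul (measurable_conj_entry c p l)
  rw [integral_map (measurable_matrix_mul_left S).aemeasurable hm.aestronglyMeasurable]
  refine integral_congr_ae (Filter.Eventually.of_forall fun V => ?_)
  have e (d : Matrix (Fin N) (Fin N) ℂ) : S * V * d * (S * V)ᴴ = S * (V * d * Vᴴ) * Sᴴ := by
    simp only [Matrix.conjTranspose_mul, Matrix.mul_assoc]
  dsimp only
  rw [e, e, mul_mul_conjTranspose_apply, mul_mul_conjTranspose_apply]
  simp only [Finset.sum_mul]
  simp only [Finset.mul_sum]
  refine Finset.sum_congr rfl fun _ _ => Finset.sum_congr rfl fun _ _ =>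
    Finset.sum_congr rfl fun _ _ => Finset.sum_congr rfl fun _ _ => by ring

theorem trace_fromBlocks {m n R : Type*} [Fintype m] [Fintype n] [AddCommMonoid R]
    (A : Matrix m m R) (B : Matrix m n R) (C : Matrix n m R) (D : Matrix n n R) :
    (Matrix.fromBlocks A B C D).trace = A.trace + D.trace := by
  simp [Matrix.trace, Fintype.sum_sum_type]

theorem trace_Ublk_eq (a b c V : Matrix (Fin N) (Fin N) ℂ) :
    ((Ublk V)ᴴ * Matrix.fromBlocks 0 a aᴴ 0 * Ublk V * Matrix.fromBlocks b 0 0 c *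
        (Ublk V)ᴴ * Matrix.fromBlocks 0 a aᴴ 0 * Ublk V * Matrix.fromBlocks b 0 0 c).trace =
      ∑ q, ∑ k, ∑ p, ∑ l, (2 * (a k l * aᴴ p q)) *
        ((V * b * Vᴴ) q k * (V * cᵀ * Vᴴ) p l) := by
  have h₁ : (V * cᵀ * Vᴴ)ᵀ = Vᴴᵀ * c * Vᵀ := by
    simp only [Matrix.transpose_mul, Matrix.transpose_transpose, Matrix.mul_assoc]
  have h₂ : Vᴴᵀᴴ = Vᵀ := by
    ext i j
    simp
  have h₃ : (Vᴴ * a * Vᴴᵀ * c * Vᵀ * aᴴ * V * b).trace =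
      (a * (V * cᵀ * Vᴴ)ᵀ * (aᴴ * (V * b * Vᴴ))).trace := by
    rw [h₁]
    simpa only [Matrix.mul_assoc] using
      Matrix.trace_mul_comm Vᴴ (a * (Vᴴᵀ * c * Vᵀ) * (aᴴ * (V * b)))
  have h₄ : (Vᵀ * aᴴ * V * b * Vᴴ * a * Vᴴᵀ * c).trace =
      (Vᴴ * a * Vᴴᵀ * c * Vᵀ * aᴴ * V * b).trace := by
    simpa only [Matrix.mul_assoc] using
      Matrix.trace_mul_comm (Vᵀ * aᴴ * V * b) (Vᴴ * a * Vᴴᵀ * c)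
  have h₅ : ((Ublk V)ᴴ * Matrix.fromBlocks 0 a aᴴ 0 * Ublk V * Matrix.fromBlocks b 0 0 c *
        (Ublk V)ᴴ * Matrix.fromBlocks 0 a aᴴ 0 * Ublk V * Matrix.fromBlocks b 0 0 c).trace =
      2 * (a * (V * cᵀ * Vᴴ)ᵀ * (aᴴ * (V * b * Vᴴ))).trace := by
    simp only [Ublk, Matrix.fromBlocks_conjTranspose, Matrix.fromBlocks_multiply,
      Matrix.conjTranspose_zero, h₂, mul_zero, zero_mul, add_zero, zero_add,
      trace_fromBlocks, h₄, ← h₃]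
    ring
  rw [h₅]
  simp only [Matrix.trace, Matrix.diag_apply]
  rw [Finset.sum_comm, Finset.mul_sum]
  refine Finset.sum_congr rfl fun k _ => ?_
  rw [Matrix.mul_apply, Finset.sum_comm, Finset.mul_sum]
  refine Finset.sum_congr rfl fun p _ => ?_
  rw [Matrix.mul_apply, Matrix.mul_apply, Finset.sum_mul_sum, Finset.sum_comm, Finset.mul_sum]
  refine Finset.sum_congr rfl fun q _ => ?_
  rw [Finset.mul_sum]
  refine Finset.sum_congr rfl fun l _ => ?_
  rw [Matrix.transpose_apply]
  ring

end Moments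

/-- For `N ≥ 2`, `A = (0, a; a*, 0)` and `B = diag(b, c)`, averaging `Tr(U*AUBU*AUB)` over
`U = diag(V, V̄)` with `V` Haar-distributed on `U(N)` gives
`(2·Tr(a*a)·(N·Tr(b)·Tr(c) − Tr(b·cᵗ)) + 2·Tr(ā·a)·(N·Tr(b·cᵗ) − Tr(b)·Tr(c))) / (N(N²−1))`. -/
theorem blockdiag_unitary_fourth_moment (N : ℕ) (hN : 2 ≤ N)
    (a b c : Matrix (Fin N) (Fin N) ℂ)
    (μ : Measure (Matrix (Fin N) (Fin N) ℂ)) [IsProbabilityMeasure μ]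
    (hmem : ∀ᵐ V ∂μ, V ∈ Matrix.unitaryGroup (Fin N) ℂ)
    (hinv : ∀ S ∈ Matrix.unitaryGroup (Fin N) ℂ, μ.map (fun V => S * V) = μ) :
    ∫ V, ((Ublk V)ᴴ * Matrix.fromBlocks 0 a aᴴ 0 * Ublk V * Matrix.fromBlocks b 0 0 c *
        (Ublk V)ᴴ * Matrix.fromBlocks 0 a aᴴ 0 * Ublk V * Matrix.fromBlocks b 0 0 c).trace ∂μ =
      (2 * (aᴴ * a).trace * ((N : ℂ) * b.trace * c.trace - (b * cᵀ).trace) +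
        2 * (aᴴᵀ * a).trace * ((N : ℂ) * (b * cᵀ).trace - b.trace * c.trace)) /
        ((N : ℂ) * ((N : ℂ) ^ 2 - 1)) := by
  have : Nontrivial (Fin N) := Fin.nontrivial_iff_two_le.2 hN
  simp only [trace_Ublk_eq]
  rw [integral_sum_conj_entry_mul hmem]
  obtain ⟨α, β, h⟩ := (conjInvariant_moment hmem hinv b cᵀ).exists_coeff
  have h₁ := integral_sum_conj_entry_mul hmem b cᵀ
    fun q k p l => (1 : Matrix (Fin N) (Fin N) ℂ) q k * (1 : Matrix (Fin N) (Fin N) ℂ) p l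
  have h₂ := integral_sum_conj_entry_mul hmem b cᵀ
    fun q k p l => (1 : Matrix (Fin N) (Fin N) ℂ) q l * (1 : Matrix (Fin N) (Fin N) ℂ) p k
  have e₁ : ∀ᵐ V ∂μ, ∑ q, ∑ k, ∑ p, ∑ l, (1 : Matrix (Fin N) (Fin N) ℂ) q k *
      (1 : Matrix (Fin N) (Fin N) ℂ) p l * ((V * b * Vᴴ) q k * (V * cᵀ * Vᴴ) p l) =
      b.trace * c.trace := by
    filter_upwards [hmem] with V hV
    have t (d : Matrix (Fin N) (Fin N) ℂ) : (V * d * Vᴴ).trace = d.trace := by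
      rw [Matrix.trace_mul_comm, ← Matrix.mul_assoc, ← Matrix.star_eq_conjTranspose,
        Matrix.mem_unitaryGroup_iff'.1 hV, Matrix.one_mul]
    rw [← t b, ← Matrix.trace_transpose c, ← t cᵀ]
    simp [Matrix.one_apply, ite_mul, Matrix.trace, Finset.sum_mul_sum]
  have e₂ : ∀ᵐ V ∂μ, ∑ q, ∑ k, ∑ p, ∑ l, (1 : Matrix (Fin N) (Fin N) ℂ) q l *
      (1 : Matrix (Fin N) (Fin N) ℂ) p k * ((V * b * Vᴴ) q k * (V * cᵀ * Vᴴ) p l) =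
      (b * cᵀ).trace := by
    filter_upwards [hmem] with V hV
    have hV' : Vᴴ * V = 1 := Matrix.mem_unitaryGroup_iff'.1 hV
    have t : (V * b * Vᴴ * (V * cᵀ * Vᴴ)).trace = (b * cᵀ).trace := by
      have : V * b * Vᴴ * (V * cᵀ * Vᴴ) = V * (b * cᵀ) * Vᴴ := by
        calc _ = V * b * (Vᴴ * V) * cᵀ * Vᴴ := by simp only [Matrix.mul_assoc]
          _ = _ := by rw [hV', Matrix.mul_one, Matrix.mul_assoc V]
      rw [this, Matrix.trace_mul_comm, ← Matrix.mul_assoc, hV', Matrix.one_mul]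
    rw [← t, Matrix.trace]
    simp only [Matrix.diag_apply, Matrix.mul_apply (M := V * b * Vᴴ)]
    simp [Matrix.one_apply, ite_mul]
  rw [integral_congr_ae e₁] at h₁
  rw [integral_congr_ae e₂] at h₂
  simp only [h] at h₁ h₂ ⊢
  simp [Matrix.one_apply, ite_mul, mul_add, Finset.sum_add_distrib] at h₁ h₂
  have e₃ : ∑ q, ∑ k, ∑ p, ∑ l, 2 * (a k l * aᴴ p q) *
      (α * ((1 : Matrix (Fin N) (Fin N) ℂ) q k * (1 : Matrix (Fin N) (Fin N) ℂ) p l) +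
        β * ((1 : Matrix (Fin N) (Fin N) ℂ) q l * (1 : Matrix (Fin N) (Fin N) ℂ) p k)) =
      2 * (aᴴ * a).trace * α + 2 * (aᴴᵀ * a).trace * β := by
    have t₁ : (aᴴ * a).trace = ∑ q, ∑ p, a q p * aᴴ p q := by
      rw [Matrix.trace_mul_comm]
      rfl
    have t₂ : (aᴴᵀ * a).trace = ∑ q, ∑ p, a p q * aᴴ p q := by
      rw [Matrix.trace_mul_comm, Matrix.trace, Finset.sum_comm]
      rfl
    rw [t₁, t₂]
    simp only [Matrix.one_apply, mul_add, Finset.sum_add_distrib, Finset.mul_sum, Finset.sum_mul,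
      mul_ite, mul_one, mul_zero, Finset.sum_ite_eq, Finset.sum_ite_eq', Finset.mem_univ,
      if_true, Finset.sum_ite_irrel, Finset.sum_const_zero]
  rw [e₃]
  have hN0 : (N : ℂ) ≠ 0 := by
    exact_mod_cast (by omega : N ≠ 0)
  have hN1 : (N : ℂ) ^ 2 - 1 ≠ 0 := by
    have : N ^ 2 ≠ 1 := by nlinarith
    exact sub_ne_zero.2 (by exact_mod_cast this)
  rw [eq_div_iff (mul_ne_zero hN0 hN1)]
  linear_combination (-2 * (aᴴ * a).trace) * ((N : ℂ) * h₁ - h₂) -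
    2 * (aᴴᵀ * a).trace * ((N : ℂ) * h₂ - h₁)
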